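/- Let X be an SL-space with spatial part Y and let U ⊆ X. Then U is a clopen Scott upset of X if and only if there is a compact open subset V of Y (with respect to the topology on Y) such that cl V = U, where cl denotes closure in X. -/

import Mathlib

open Set Topology

/-- Clopen upsets of a topological space with a partial order. -/
def ClopUp (X : Type*) [TopologicalSpace X] [Preorder X] : Set (Set X) :=
  {U | IsClopen U ∧ IsUpperSet U}

/-- Downward closure of a set. -/
def downClosure (X : Type*) [Preorder X] (A : Set X) : Set X := {x | ∃ y ∈ A, x ≤ y}

/-- Priestley space: compact, and clopen upsets separate points via the Priestley separation axiom. -/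
def IsPriestley (X : Type*) [TopologicalSpace X] [Preorder X] : Prop :=
  CompactSpace X ∧ ∀ x y : X, ¬x ≤ y → ∃ U ∈ ClopUp X, x ∈ U ∧ y ∉ U

/-- Esakia space: a Priestley space in which downward closures of clopens are clopen. -/
def IsEsakia (X : Type*) [TopologicalSpace X] [Preorder X] : Prop :=
  IsPriestley X ∧ ∀ U : Set X, IsClopen U → IsClopen (downClosure X U)

/-- L-space: an extremally order-disconnected Esakia space. -/
def IsLSpace (X : Type*) [TopologicalSpace X] [Preorder X] : Prop :=
  IsEsakia X ∧ ∀ U : Set X, IsOpen U → IsUpperSet U → IsOpen (closure U)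

/-- The spatial part of an L-space: points with clopen downset. -/
def spatialPart (X : Type*) [TopologicalSpace X] [Preorder X] : Set X :=
  {y : X | IsClopen {x : X | x ≤ y}}

/-- Scott upset: a closed upset all of whose minimal points lie in the spatial part. -/
def IsScottUpset (X : Type*) [TopologicalSpace X] [Preorder X] (F : Set X) : Prop :=
  IsClosed F ∧ IsUpperSet F ∧ ∀ y ∈ F, (∀ z ∈ F, z ≤ y → z = y) → y ∈ spatialPart X

/-- Clopen Scott upsets. -/
def ClopSUp (X : Type*) [TopologicalSpace X] [Preorder X] : Set (Set X) :=
  {U | IsClopen U ∧ IsScottUpset X U}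

/-- Clopen bisets (both upsets and downsets). -/
def ClopBi (X : Type*) [TopologicalSpace X] [Preorder X] : Set (Set X) :=
  {U | IsClopen U ∧ IsUpperSet U ∧ IsLowerSet U}

/-- `V ≪ U` for clopen upsets: every open upset whose closure contains `U` contains `V`. -/
def wayBelowSet (X : Type*) [TopologicalSpace X] [Preorder X] (V U : Set X) : Prop :=
  ∀ W : Set X, IsOpen W → IsUpperSet W → U ⊆ closure W → V ⊆ W

/-- The kernel of a clopen upset. -/
def kerSet (X : Type*) [TopologicalSpace X] [Preorder X] (U : Set X) : Set X :=
  ⋃₀ {V | V ∈ ClopUp X ∧ wayBelowSet X V U}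

/-- The core of a clopen upset. -/
def coreSet (X : Type*) [TopologicalSpace X] [Preorder X] (U : Set X) : Set X :=
  ⋃₀ {V | V ∈ ClopSUp X ∧ V ⊆ U}

/-- The regular part of a clopen upset. -/
def regSet (X : Type*) [TopologicalSpace X] [Preorder X] (U : Set X) : Set X :=
  ⋃₀ {V | V ∈ ClopUp X ∧ downClosure X V ⊆ U}

/-- The center of a clopen upset. -/
def cenSet (X : Type*) [TopologicalSpace X] [Preorder X] (U : Set X) : Set X :=
  ⋃₀ {V | V ∈ ClopBi X ∧ V ⊆ U}

/-- The topology on the spatial part, generated by traces of clopen upsets. -/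
def spatialTop (X : Type*) [TopologicalSpace X] [Preorder X] :
    TopologicalSpace (spatialPart X) :=
  TopologicalSpace.generateFrom
    {V : Set (spatialPart X) | ∃ U ∈ ClopUp X, V = ((↑) : spatialPart X → X) ⁻¹' U}

/-- An algebraic L-space: the core of every clopen upset is dense in it. -/
def IsAlgebraicLSpace (X : Type*) [TopologicalSpace X] [Preorder X] : Prop :=
  IsLSpace X ∧ ∀ U ∈ ClopUp X, U ⊆ closure (coreSet X U)

/-- A space is compactly based if compact open sets form a basis. -/
def CompactlyBased (Y : Type*) [TopologicalSpace Y] : Prop :=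
  ∀ V : Set Y, IsOpen V → ∀ y ∈ V, ∃ K : Set Y, IsOpen K ∧ IsCompact K ∧ y ∈ K ∧ K ⊆ V

/-- A set is saturated if it is the intersection of the open sets containing it. -/
def IsSaturatedSet {Y : Type*} [TopologicalSpace Y] (K : Set Y) : Prop :=
  K = ⋂₀ {U : Set Y | IsOpen U ∧ K ⊆ U}

/-- The way-below relation in a frame. -/
def frameWayBelow {L : Type*} [Order.Frame L] (a b : L) : Prop :=
  ∀ S : Set L, b ≤ sSup S → ∃ T : Set L, T ⊆ S ∧ T.Finite ∧ a ≤ sSup T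

/-- A compact element of a frame. -/
def IsCompactElt {L : Type*} [Order.Frame L] (a : L) : Prop := frameWayBelow a a

/-- An algebraic frame: every element is the join of the compact elements below it. -/
def AlgebraicFrame (L : Type*) [Order.Frame L] : Prop :=
  ∀ a : L, a = sSup {k : L | IsCompactElt k ∧ k ≤ a}

/-- An arithmetic frame: algebraic with stable way-below relation. -/
def ArithmeticFrame (L : Type*) [Order.Frame L] : Prop :=
  AlgebraicFrame L ∧
    ∀ a b c : L, frameWayBelow a b → frameWayBelow a c → frameWayBelow a (b ⊓ c)

/-- A coherent frame: arithmetic and compact. -/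
def CoherentFrame (L : Type*) [Order.Frame L] : Prop :=
  ArithmeticFrame L ∧ IsCompactElt (⊤ : L)

/-- A prime filter of a frame. -/
def IsPrimeFilter {L : Type*} [Order.Frame L] (F : Set L) : Prop :=
  F.Nonempty ∧ F ≠ Set.univ ∧ (∀ a ∈ F, ∀ b : L, a ≤ b → b ∈ F) ∧
    (∀ a ∈ F, ∀ b ∈ F, a ⊓ b ∈ F) ∧ ∀ a b : L, a ⊔ b ∈ F → a ∈ F ∨ b ∈ F

/-- A completely prime filter of a frame. -/
def IsCompletelyPrimeFilter {L : Type*} [Order.Frame L] (F : Set L) : Prop :=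
  F.Nonempty ∧ F ≠ Set.univ ∧ (∀ a ∈ F, ∀ b : L, a ≤ b → b ∈ F) ∧
    (∀ a ∈ F, ∀ b ∈ F, a ⊓ b ∈ F) ∧ ∀ S : Set L, sSup S ∈ F → ∃ s ∈ S, s ∈ F

/-- The Priestley space of a frame: prime filters ordered by inclusion. -/
abbrev PriestleyDual (L : Type*) [Order.Frame L] : Type _ := {F : Set L // IsPrimeFilter F}

/-- The Priestley topology on the Priestley space of a frame. -/
instance PriestleyDual.instTopologicalSpace (L : Type*) [Order.Frame L] :
    TopologicalSpace (PriestleyDual L) :=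
  TopologicalSpace.generateFrom
    ({S : Set (PriestleyDual L) | ∃ a : L, S = {x | a ∈ x.val}} ∪
     {S : Set (PriestleyDual L) | ∃ a : L, S = {x | a ∈ x.val}ᶜ})

section PriestleyLemmas

variable {X : Type*} [TopologicalSpace X]

theorem ClopUp.empty_mem [Preorder X] : (∅ : Set X) ∈ ClopUp X :=
  ⟨isClopen_empty, isUpperSet_empty⟩

theorem ClopUp.union_mem [Preorder X] {A B : Set X} (hA : A ∈ ClopUp X) (hB : B ∈ ClopUp X) :
    A ∪ B ∈ ClopUp X :=
  ⟨hA.1.union hB.1, hA.2.union hB.2⟩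

theorem ClopUp.inter_mem [Preorder X] {A B : Set X} (hA : A ∈ ClopUp X) (hB : B ∈ ClopUp X) :
    A ∩ B ∈ ClopUp X :=
  ⟨hA.1.inter hB.1, hA.2.inter hB.2⟩

theorem IsPriestley.isClosed_Iic [Preorder X] (hX : IsPriestley X) (x : X) :
    IsClosed (Iic x) := by
  rw [← isOpen_compl_iff, isOpen_iff_mem_nhds]
  intro z hz
  obtain ⟨A, hA, hzA, hxA⟩ := hX.2 z x hz
  exact Filter.mem_of_superset (hA.1.isOpen.mem_nhds hzA) fun w hw hwx => hxA (hA.2 hwx hw)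

theorem IsPriestley.totallySeparatedSpace [PartialOrder X] (hX : IsPriestley X) :
    TotallySeparatedSpace X := by
  rw [totallySeparatedSpace_iff_exists_isClopen]
  intro x y hxy
  by_cases h : x ≤ y
  · obtain ⟨A, hA, hyA, hxA⟩ := hX.2 y x fun h' => hxy (le_antisymm h h')
    exact ⟨Aᶜ, hA.1.compl, hxA, fun hn => hn hyA⟩
  · obtain ⟨A, hA, hxA, hyA⟩ := hX.2 x y h
    exact ⟨A, hA.1, hxA, hyA⟩

/-- In a Priestley space every point of a closed set is above a minimal point of that set. -/
theorem IsPriestley.exists_minimal_le [PartialOrder X] (hX : IsPriestley X) {F : Set X}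
    (hF : IsClosed F) {x : X} (hx : x ∈ F) : ∃ m ≤ x, Minimal (· ∈ F) m := by
  have : CompactSpace X := hX.1
  refine zorn_le_nonempty₀ (α := Xᵒᵈ) F (fun c hcF hc y hy => ?_) x hx
  obtain ⟨z, hz⟩ : (⋂₀ ((fun w : X => F ∩ Iic w) '' c)).Nonempty := by
    refine IsCompact.nonempty_sInter_of_directed_nonempty_isCompact_isClosed
      (hS := ⟨⟨_, mem_image_of_mem _ hy⟩⟩) ?_ ?_ ?_ ?_
    · rintro _ ⟨a, ha, rfl⟩ _ ⟨b, hb, rfl⟩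
      rcases hc.total ha hb with h | h
      · exact ⟨_, mem_image_of_mem _ hb, inter_subset_inter_right _ (Iic_subset_Iic.2 h),
          subset_rfl⟩
      · exact ⟨_, mem_image_of_mem _ ha, subset_rfl,
          inter_subset_inter_right _ (Iic_subset_Iic.2 h)⟩
    · rintro _ ⟨a, ha, rfl⟩
      exact ⟨a, hcF ha, le_rfl⟩
    · rintro _ ⟨a, -, rfl⟩
      exact (hF.inter (hX.isClosed_Iic a)).isCompact
    · rintro _ ⟨a, -, rfl⟩
      exact hF.inter (hX.isClosed_Iic a)
  have hz' : ∀ a ∈ c, z ∈ F ∩ Iic a := fun a ha => hz _ (mem_image_of_mem _ ha)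
  exact ⟨z, (hz' y hy).1, fun a ha => (hz' a ha).2⟩

theorem IsEsakia.isUpperSet_closure [PartialOrder X] (hX : IsEsakia X) {W : Set X}
    (hW : IsUpperSet W) : IsUpperSet (closure W) := by
  have : CompactSpace X := hX.1.1
  have : TotallySeparatedSpace X := hX.1.totallySeparatedSpace
  intro x y hxy hx
  by_contra hy
  obtain ⟨N, hN, hyN, hNW⟩ := compact_exists_isClopen_in_isOpen isClosed_closure.isOpen_compl hy
  obtain ⟨w, ⟨n, hn, hwn⟩, hwW⟩ :=
    mem_closure_iff.1 hx _ (hX.2 N hN).isOpen ⟨y, hyN, hxy⟩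
  exact hNW hn (subset_closure (hW hwn hwW))

end PriestleyLemmas

section SpatialPart

variable {X : Type*} [TopologicalSpace X]

theorem isTopologicalBasis_spatialTop (X : Type*) [TopologicalSpace X] [Preorder X] :
    @TopologicalSpace.IsTopologicalBasis _ (spatialTop X)
      {V : Set (spatialPart X) | ∃ U ∈ ClopUp X, V = ((↑) : spatialPart X → X) ⁻¹' U} := by
  let := spatialTop X
  refine ⟨?_, ?_, rfl⟩
  · rintro _ ⟨A, hA, rfl⟩ _ ⟨B, hB, rfl⟩ x hx
    exact ⟨_, ⟨A ∩ B, ClopUp.inter_mem hA hB, rfl⟩, hx, subset_rfl⟩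
  · exact sUnion_eq_univ_iff.2 fun x =>
      ⟨_, ⟨univ, ⟨isClopen_univ, isUpperSet_univ⟩, rfl⟩, mem_univ (x : X)⟩

theorem isOpen_spatialTop_preimage [Preorder X] {A : Set X} (hA : A ∈ ClopUp X) :
    IsOpen[spatialTop X] (((↑) : spatialPart X → X) ⁻¹' A) :=
  TopologicalSpace.isOpen_generateFrom_of_mem ⟨A, hA, rfl⟩

/-- A compact subset of the spatial part that is covered by clopen upsets from a family closed
under finite unions is contained in a member of the family. -/
theorem exists_clopUp_of_isCompact [Preorder X] {V : Set (spatialPart X)}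
    (hV : @IsCompact _ (spatialTop X) V) {P : Set X → Prop} (hempty : P ∅)
    (hunion : ∀ A B, P A → P B → P (A ∪ B))
    (hcover : ∀ y ∈ V, ∃ A ∈ ClopUp X, P A ∧ (y : X) ∈ A) :
    ∃ A ∈ ClopUp X, P A ∧ V ⊆ ((↑) : spatialPart X → X) ⁻¹' A := by
  let := spatialTop X
  refine IsCompact.induction_on (p := fun s => ∃ A ∈ ClopUp X, P A ∧
    s ⊆ ((↑) : spatialPart X → X) ⁻¹' A) hV ⟨∅, ClopUp.empty_mem, hempty, empty_subset _⟩ ?_ ?_ ?_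
  · rintro s t hst ⟨A, hA, hPA, htA⟩
    exact ⟨A, hA, hPA, hst.trans htA⟩
  · rintro s t ⟨A, hA, hPA, hsA⟩ ⟨B, hB, hPB, htB⟩
    exact ⟨A ∪ B, ClopUp.union_mem hA hB, hunion A B hPA hPB, union_subset_union hsA htB⟩
  · intro y hy
    obtain ⟨A, hA, hPA, hyA⟩ := hcover y hy
    exact ⟨_, mem_nhdsWithin_of_mem_nhds ((isOpen_spatialTop_preimage hA).mem_nhds hyA),
      A, hA, hPA, subset_rfl⟩

theorem exists_clopUp_eq_preimage [Preorder X] {V : Set (spatialPart X)}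
    (hVo : IsOpen[spatialTop X] V) (hVc : @IsCompact _ (spatialTop X) V) :
    ∃ A ∈ ClopUp X, V = ((↑) : spatialPart X → X) ⁻¹' A := by
  obtain ⟨A, hA, hAV, hVA⟩ := exists_clopUp_of_isCompact hVc
    (P := fun A => ((↑) : spatialPart X → X) ⁻¹' A ⊆ V) (empty_subset _)
    (fun A B hA hB => union_subset hA hB) (fun y hy => by
      let := spatialTop X
      obtain ⟨_, ⟨A, hA, rfl⟩, hyA, hAV⟩ :=
        (isTopologicalBasis_spatialTop X).exists_subset_of_mem_open hy hVo
      exact ⟨A, hA, hAV, hyA⟩)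
  exact ⟨A, hA, hVA.antisymm hAV⟩

theorem closure_image_preimage_spatialPart [Preorder X] (hSL : Dense (spatialPart X)) {A : Set X}
    (hA : IsClopen A) :
    closure (((↑) : spatialPart X → X) '' (((↑) : spatialPart X → X) ⁻¹' A)) = A := by
  rw [Subtype.image_preimage_coe, inter_comm]
  exact (closure_minimal inter_subset_left hA.isClosed).antisymm
    (hSL.open_subset_closure_inter hA.isOpen)

theorem isCompact_preimage_of_isScottUpset [PartialOrder X] (hX : IsPriestley X) {U : Set X}
    (hU : IsScottUpset X U) :
    @IsCompact _ (spatialTop X) (((↑) : spatialPart X → X) ⁻¹' U) := by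
  have : CompactSpace X := hX.1
  let := spatialTop X
  refine isCompact_generateFrom rfl fun P hP hUP => ?_
  have hcov : U ⊆ ⋃₀ {A | A ∈ ClopUp X ∧ ((↑) : spatialPart X → X) ⁻¹' A ∈ P} := by
    intro x hx
    obtain ⟨m, hmx, hm⟩ := hX.exists_minimal_le hU.1 hx
    have hmY : m ∈ spatialPart X :=
      hU.2.2 m hm.prop fun z hz hzm => le_antisymm hzm (hm.le_of_le hz hzm)
    obtain ⟨B, hB, hmB⟩ := hUP (show (⟨m, hmY⟩ : spatialPart X) ∈ _ from hm.prop)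
    obtain ⟨A, hA, rfl⟩ := hP hB
    exact ⟨A, ⟨hA, hB⟩, hA.2 hmx hmB⟩
  obtain ⟨T, hTP, hT, hUT⟩ :=
    hU.1.isCompact.elim_finite_subcover_image (c := fun A => A) (fun A hA => hA.1.1.isOpen)
      (sUnion_eq_biUnion ▸ hcov)
  refine ⟨(fun A => ((↑) : spatialPart X → X) ⁻¹' A) '' T, ?_, hT.image _, ?_⟩
  · rintro _ ⟨A, hA, rfl⟩
    exact (hTP hA).2
  · intro y hy
    obtain ⟨A, hA, hyA⟩ := mem_iUnion₂.1 (hUT hy)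
    exact ⟨_, mem_image_of_mem _ hA, hyA⟩

/-- The closure of a compact subset of the spatial part is way below itself with respect to
complements of principal downsets. -/
theorem not_closure_image_subset_closure_compl_Iic [PartialOrder X] (hX : IsPriestley X)
    {V : Set (spatialPart X)} (hV : @IsCompact _ (spatialTop X) V) {x : X}
    (hx : x ∈ closure (((↑) : spatialPart X → X) '' V)) :
    ¬ closure (((↑) : spatialPart X → X) '' V) ⊆ closure (Iic x)ᶜ := by
  intro h
  obtain ⟨A, hA, hxA, hVA⟩ := exists_clopUp_of_isCompact hV (P := fun A => x ∉ A)
    (notMem_empty x) (fun A B hA hB => by simp [hA, hB]) (fun y hy => by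
      have hyW := h (subset_closure (mem_image_of_mem _ hy))
      obtain ⟨w, hwy, hwx⟩ := mem_closure_iff.1 hyW (Iic (y : X)) y.2.isOpen self_mem_Iic
      obtain ⟨A, hA, hwA, hxA⟩ := hX.2 w x hwx
      exact ⟨A, hA, hxA, hA.2 hwy hwA⟩)
  exact hxA (closure_minimal (image_subset_iff.2 hVA) hA.1.isClosed hx)

theorem mem_spatialPart_of_minimal_closure_image [PartialOrder X] (hX : IsLSpace X)
    {V : Set (spatialPart X)} (hV : @IsCompact _ (spatialTop X) V) {x : X}
    (hx : Minimal (· ∈ closure (((↑) : spatialPart X → X) '' V)) x) : x ∈ spatialPart X := by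
  obtain ⟨z, hzU, hzW⟩ :=
    not_subset.1 (not_closure_image_subset_closure_compl_Iic hX.1.1 hV hx.prop)
  have hzx : z ≤ x := by
    by_contra hn
    exact hzW (subset_closure hn)
  obtain rfl : z = x := le_antisymm hzx (hx.le_of_le hzU hzx)
  have hup : IsUpperSet (Iic z)ᶜ := (isLowerSet_Iic z).compl
  have heq : Iic z = (closure (Iic z)ᶜ)ᶜ := by
    refine subset_antisymm (fun w hw hwW => hzW (hX.1.isUpperSet_closure hup hw hwW)) ?_
    rw [compl_subset_comm]
    exact subset_closure
  have hclopen : IsClopen (Iic z) := by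
    rw [heq]
    exact IsClopen.compl
      ⟨isClosed_closure, hX.2 _ (hX.1.1.isClosed_Iic z).isOpen_compl hup⟩
  exact hclopen

end SpatialPart

/-- in an SL-space, clopen Scott upsets are exactly closures of
compact open subsets of the spatial part. -/
theorem stmt6 {X : Type*} [TopologicalSpace X] [PartialOrder X]
    (hX : IsLSpace X) (hSL : Dense (spatialPart X)) (U : Set X) :
    U ∈ ClopSUp X ↔
      ∃ V : Set (spatialPart X), IsOpen[spatialTop X] V ∧ @IsCompact _ (spatialTop X) V ∧
        closure (((↑) : spatialPart X → X) '' V) = U := by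
  constructor
  · rintro ⟨hU, hS⟩
    exact ⟨_, isOpen_spatialTop_preimage ⟨hU, hS.2.1⟩,
      isCompact_preimage_of_isScottUpset hX.1.1 hS, closure_image_preimage_spatialPart hSL hU⟩
  · rintro ⟨V, hVo, hVc, rfl⟩
    have hclopUp : closure (((↑) : spatialPart X → X) '' V) ∈ ClopUp X := by
      obtain ⟨A, hA, rfl⟩ := exists_clopUp_eq_preimage hVo hVc
      rwa [closure_image_preimage_spatialPart hSL hA.1]
    exact ⟨hclopUp.1, hclopUp.1.isClosed, hclopUp.2, fun y hy hmin =>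
      mem_spatialPart_of_minimal_closure_image hX hVc
        ⟨hy, fun z hz hzy => (hmin z hz hzy).ge⟩⟩
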